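/- Let p be a prime, let U ⊆ ℚ_p be an open set, and let f : ℚ_p → ℚ_p be a function whose graph over U, {(x, f x) : x ∈ U}, is definable. Then there is a finite set F ⊆ U such that for every a ∈ U \ F the function f is strictly differentiable at a within U: there exists L ∈ ℚ_p such that (f y - f x)/(y - x) tends to L as (x, y) tends to (a, a) with x, y ∈ U and x ≠ y. -/

import Mathlib

open FirstOrder Filter Topology

/-- The ring-language structure on `ℚ_[p]`. -/
noncomputable instance (p : ℕ) [Fact p.Prime] : FirstOrder.Language.ring.Structure ℚ_[p] :=
  (FirstOrder.Ring.compatibleRingOfRing ℚ_[p]).toStructure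

namespace PadicDefinable

open Polynomial

variable {p : ℕ} [Fact p.Prime]

/-! ### Leading terms -/

/-- `u` and `v` have the same leading term up to relative precision `ε`. -/
def RvRel (ε : ℝ) (u v : ℚ_[p]) : Prop := ‖u - v‖ ≤ ε * ‖v‖

namespace RvRel

variable {ε η : ℝ} {u v w u' v' : ℚ_[p]}

lemma refl (hε : 0 ≤ ε) (u : ℚ_[p]) : RvRel ε u u := by
  simp only [RvRel, sub_self, norm_zero]; positivity

lemma mono (h : RvRel ε u v) (hε : ε ≤ η) : RvRel η u v :=
  h.trans (by gcongr)

lemma norm_eq (h : RvRel ε u v) (hε : ε < 1) : ‖u‖ = ‖v‖ := by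
  rcases eq_or_ne v 0 with rfl | hv
  · have : ‖u‖ ≤ 0 := by simpa [RvRel] using h
    simp [norm_le_zero_iff.1 this]
  · have hlt : ‖u - v‖ < ‖v‖ := h.trans_lt (mul_lt_of_lt_one_left (norm_pos_iff.2 hv) hε)
    have := IsUltrametricDist.norm_add_eq_max_of_norm_ne_norm hlt.ne
    rwa [sub_add_cancel, max_eq_right hlt.le] at this

lemma symm (h : RvRel ε u v) (hε : ε < 1) : RvRel ε v u := by
  unfold RvRel; rw [norm_sub_rev, h.norm_eq hε]; exact h

lemma trans (h : RvRel ε u v) (h' : RvRel ε v w) (hε : ε < 1) : RvRel ε u w := by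
  unfold RvRel at *
  rw [← sub_add_sub_cancel u v w]
  refine (IsUltrametricDist.norm_add_le_max _ _).trans (max_le ?_ h')
  rwa [← RvRel.norm_eq h' hε]

lemma eq_zero_iff (h : RvRel ε u v) (hε : ε < 1) : u = 0 ↔ v = 0 := by
  rw [← norm_eq_zero, h.norm_eq hε, norm_eq_zero]

lemma mul (h : RvRel ε u v) (h' : RvRel ε u' v') (hε : ε < 1) :
    RvRel ε (u * u') (v * v') := by
  have e : u * u' - v * v' = (u - v) * u' + v * (u' - v') := by ring
  unfold RvRel
  rw [e]
  refine (IsUltrametricDist.norm_add_le_max _ _).trans (max_le ?_ ?_)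
  · rw [norm_mul, norm_mul, h'.norm_eq hε, ← mul_assoc]
    exact mul_le_mul_of_nonneg_right h (norm_nonneg _)
  · rw [norm_mul, norm_mul, mul_left_comm]
    exact mul_le_mul_of_nonneg_left h' (norm_nonneg _)

lemma pow (h : RvRel ε u v) (h0 : 0 ≤ ε) (hε : ε < 1) (n : ℕ) : RvRel ε (u ^ n) (v ^ n) := by
  induction n with
  | zero => simpa only [pow_zero] using refl h0 1
  | succ n ih => simpa [pow_succ] using ih.mul h hε

lemma inv (h : RvRel ε u v) (hε : ε < 1) : RvRel ε u⁻¹ v⁻¹ := by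
  have hn := h.norm_eq hε
  rcases eq_or_ne v 0 with rfl | hv
  · obtain rfl : u = 0 := by simpa using hn
    simp [RvRel]
  · have hu : u ≠ 0 := fun h0 => hv ((h.eq_zero_iff hε).1 h0)
    have hv' : 0 < ‖v‖ := norm_pos_iff.2 hv
    unfold RvRel at *
    rw [inv_sub_inv hu hv, norm_div, norm_mul, hn, norm_sub_rev, norm_inv,
      div_le_iff₀ (by positivity)]
    calc ‖u - v‖ ≤ ε * ‖v‖ := h
      _ = _ := by field_simp

lemma neg (h : RvRel ε u v) : RvRel ε (-u) (-v) := by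
  unfold RvRel at *
  rwa [← neg_sub', norm_neg, norm_neg]

lemma div (h : RvRel ε u v) (h' : RvRel ε u' v') (hε : ε < 1) :
    RvRel ε (u / u') (v / v') := by
  simpa [div_eq_mul_inv] using h.mul (h'.inv hε) hε

end RvRel

/-! ### The Gauss norm of a polynomial -/

/-- The largest norm of a monomial of `q` on the circle of radius `r`. -/
noncomputable abbrev gn (q : ℚ_[p][X]) (r : ℝ) : ℝ :=
  q.gaussNorm (NormedField.toAbsoluteValue ℚ_[p]) r

variable {q q' : ℚ_[p][X]} {r ε δ θ : ℝ} {u w w' z : ℚ_[p]}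

lemma le_gn (hr : 0 ≤ r) (q : ℚ_[p][X]) (i : ℕ) : ‖q.coeff i‖ * r ^ i ≤ gn q r :=
  le_gaussNorm (NormedField.toAbsoluteValue ℚ_[p]) q hr i

lemma gn_le {M : ℝ} (h : ∀ i, ‖q.coeff i‖ * r ^ i ≤ M) : gn q r ≤ M := by
  obtain ⟨i, hi⟩ := q.exists_eq_gaussNorm (NormedField.toAbsoluteValue ℚ_[p]) r
  exact hi.trans_le (h i)

lemma exists_gn_eq (q : ℚ_[p][X]) (r : ℝ) : ∃ i, gn q r = ‖q.coeff i‖ * r ^ i :=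
  exists_eq_gaussNorm (NormedField.toAbsoluteValue ℚ_[p]) r q

lemma gn_zero_right (q : ℚ_[p][X]) : gn q 0 = ‖q.coeff 0‖ :=
  gaussNorm_zero_right (NormedField.toAbsoluteValue ℚ_[p]) q

lemma gn_nonneg (hr : 0 ≤ r) : 0 ≤ gn q r := gaussNorm_nonneg _ _ hr

lemma gn_pos (hr : 0 < r) (hq : q ≠ 0) : 0 < gn q r := by
  refine (gn_nonneg hr.le).lt_of_ne fun h => hq ?_
  exact (gaussNorm_eq_zero_iff _ _ (fun x hx => by simpa using hx) hr).1 h.symm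

lemma norm_eval_le (q : ℚ_[p][X]) (w : ℚ_[p]) : ‖q.eval w‖ ≤ gn q ‖w‖ := by
  rw [eval_eq_sum_range]
  refine IsUltrametricDist.norm_sum_le_of_forall_le_of_nonneg (gn_nonneg (norm_nonneg _)) ?_
  intro i _
  rw [norm_mul, norm_pow]
  exact le_gn (norm_nonneg _) q i

lemma gn_congr (hδ : δ < 1) (h : ∀ i, RvRel δ (q.coeff i) (q'.coeff i)) (hr : 0 ≤ r) :
    gn q r = gn q' r := by
  have hn i := (h i).norm_eq hδ
  exact le_antisymm (gn_le fun i => hn i ▸ le_gn hr q' i) (gn_le fun i => hn i ▸ le_gn hr q i)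

/-- Perturbing the coefficients and the argument of a polynomial. -/
lemma norm_eval_sub_eval_le (h0 : 0 ≤ δ) (hδ : δ < 1)
    (h : ∀ i, RvRel δ (q.coeff i) (q'.coeff i)) (hw : RvRel δ w w') :
    ‖q.eval w - q'.eval w'‖ ≤ δ * gn q' ‖w'‖ := by
  set n := max q.natDegree q'.natDegree + 1
  rw [eval_eq_sum_range' (n := n) (by omega), eval_eq_sum_range' (n := n) (by omega),
    ← Finset.sum_sub_distrib]
  refine IsUltrametricDist.norm_sum_le_of_forall_le_of_nonneg
    (mul_nonneg h0 (gn_nonneg (norm_nonneg _))) fun i _ => ?_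
  refine le_trans ((h i).mul (hw.pow h0 hδ i) hδ) ?_
  rw [norm_mul, norm_pow]
  exact mul_le_mul_of_nonneg_left (le_gn (norm_nonneg _) q' i) h0

/-- The Euler operator `X * d/dX`. -/
noncomputable abbrev euler (q : ℚ_[p][X]) : ℚ_[p][X] := X * derivative q

lemma coeff_euler (q : ℚ_[p][X]) (i : ℕ) : (euler q).coeff i = i * q.coeff i := by
  rcases i with _ | i
  · simp
  · simp [coeff_derivative, mul_comm]

lemma eval_euler (q : ℚ_[p][X]) (w : ℚ_[p]) : (euler q).eval w = w * (derivative q).eval w := by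
  simp

lemma gn_euler_le (hr : 0 ≤ r) : gn (euler q) r ≤ gn q r := by
  refine gn_le fun i => le_trans ?_ (le_gn hr q i)
  rw [coeff_euler, norm_mul]
  have : ‖(i : ℚ_[p])‖ ≤ 1 := by exact_mod_cast Padic.norm_int_le_one (i : ℤ)
  gcongr
  exact mul_le_of_le_one_left (norm_nonneg _) this

lemma euler_rel (h0 : 0 ≤ δ) (hδ : δ < 1) (h : ∀ i, RvRel δ (q.coeff i) (q'.coeff i)) (i : ℕ) :
    RvRel δ ((euler q).coeff i) ((euler q').coeff i) := by
  rw [coeff_euler, coeff_euler]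
  exact (RvRel.refl h0 _).mul (h i) hδ

lemma gn_taylor_le (hz : ‖z‖ ≤ r) : gn (taylor z q) r ≤ gn q r := by
  have hr : 0 ≤ r := (norm_nonneg z).trans hz
  refine gn_le fun i => ?_
  rw [taylor_coeff]
  refine (mul_le_mul_of_nonneg_right (norm_eval_le _ _) (pow_nonneg hr i)).trans ?_
  obtain ⟨j, hj⟩ := exists_gn_eq (hasseDeriv i q) ‖z‖
  rw [hj, hasseDeriv_coeff, norm_mul]
  have h1 : ‖((j + i).choose i : ℚ_[p])‖ ≤ 1 := by
    exact_mod_cast Padic.norm_int_le_one ((j + i).choose i : ℤ)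
  calc _ ≤ 1 * ‖q.coeff (j + i)‖ * r ^ j * r ^ i := by gcongr
    _ = ‖q.coeff (j + i)‖ * r ^ (j + i) := by ring
    _ ≤ _ := le_gn hr q _

/-- Rescaling a polynomial to integral coefficients. -/
lemma exists_integral_model (q : ℚ_[p][X]) (hw : w ≠ 0) :
    ∃ (F : ℤ_[p][X]) (m : ℚ_[p]), ‖m‖ = gn q ‖w‖ ∧
      (∀ t : ℤ_[p], q.eval (w * t) = m * (F.eval t : ℤ_[p])) ∧
      ∀ t : ℤ_[p], w * (derivative q).eval (w * t) = m * ((derivative F).eval t : ℤ_[p]) := by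
  obtain ⟨j, hj⟩ := exists_gn_eq q ‖w‖
  set m := q.coeff j * w ^ j with hm
  have hmn : ‖m‖ = gn q ‖w‖ := by rw [hm, norm_mul, norm_pow]; exact hj.symm
  rcases eq_or_ne q 0 with rfl | hq
  · exact ⟨0, m, hmn, by simp, by simp⟩
  have hm0 : m ≠ 0 := norm_pos_iff.1 (hmn ▸ gn_pos (norm_pos_iff.2 hw) hq)
  obtain ⟨F, hF⟩ : ∃ F : ℤ_[p][X], F.map PadicInt.Coe.ringHom = C m⁻¹ * q.comp (C w * X) := by
    have := (lifts_iff_coeff_lifts (f := PadicInt.Coe.ringHom (p := p))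
      (C m⁻¹ * q.comp (C w * X))).2 fun i => ?_
    · exact (mem_lifts _).1 this
    · have hle : ‖m⁻¹ * (q.coeff i * w ^ i)‖ ≤ 1 := by
        rw [norm_mul, norm_inv, hmn, norm_mul, norm_pow, ← hmn,
          inv_mul_le_one₀ (by positivity), hmn]
        exact le_gn (norm_nonneg _) q i
      exact ⟨⟨_, hle⟩, (by rw [coeff_C_mul, comp_C_mul_X_coeff]; rfl)⟩
  refine ⟨F, m, hmn, fun t => ?_, fun t => ?_⟩
  · have := congrArg (eval (t : ℚ_[p])) hF
    have h2 : (F.map PadicInt.Coe.ringHom).eval (t : ℚ_[p]) = (F.eval t : ℤ_[p]) :=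
      eval_map_apply (PadicInt.Coe.ringHom (p := p)) t
    rw [← h2, this]
    simp [hm0]
  · have hF' : derivative (F.map PadicInt.Coe.ringHom) =
        C m⁻¹ * (C w * (derivative q).comp (C w * X)) := by
      rw [hF]; simp [derivative_comp]
    have := congrArg (eval (t : ℚ_[p])) hF'
    have h2 : ((derivative F).map PadicInt.Coe.ringHom).eval (t : ℚ_[p]) =
        ((derivative F).eval t : ℤ_[p]) := eval_map_apply (PadicInt.Coe.ringHom (p := p)) t
    rw [← h2, ← derivative_map, this]
    simp [hm0]

lemma hensel (hw : w ≠ 0) (h : ‖q.eval w‖ * gn q ‖w‖ < ‖w * (derivative q).eval w‖ ^ 2) :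
    ∃ z, q.eval z = 0 ∧ ‖z - w‖ * ‖w * (derivative q).eval w‖ ≤ ‖q.eval w‖ * ‖w‖ := by
  obtain ⟨F, m, hm, hF, hF'⟩ := exists_integral_model q hw
  have e1 := hF 1
  have e2 := hF' 1
  simp only [PadicInt.coe_one, mul_one] at e1 e2
  have hm0 : 0 < ‖m‖ := by
    refine (norm_nonneg m).lt_of_ne fun h0 => ?_
    rw [e2, norm_mul, ← h0, zero_mul, ← hm, ← h0, mul_zero] at h
    norm_num at h
  rw [e1, e2, ← hm, norm_mul, norm_mul, mul_pow, mul_right_comm, sq ‖m‖] at h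
  have h' : ‖F.aeval (1 : ℤ_[p])‖ < ‖(derivative F).aeval (1 : ℤ_[p])‖ ^ 2 := by
    simpa [coe_aeval_eq_eval] using lt_of_mul_lt_mul_left h (by positivity)
  obtain ⟨z, hz, hlt, hd, -⟩ := hensels_lemma h'
  simp only [coe_aeval_eq_eval] at hz hlt hd
  refine ⟨w * z, by rw [hF, hz]; simp, ?_⟩
  obtain ⟨k, hk⟩ := F.binomExpansion z (1 - z)
  have hk' : F.eval 1 = (derivative F).eval z * (1 - z) + k * (1 - z) ^ 2 := by
    simpa [hz] using hk
  have hlt' : ‖(1 : ℤ_[p]) - z‖ < ‖(derivative F).eval z‖ := by rw [norm_sub_rev, hd]; exact hlt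
  have key : ‖(derivative F).eval 1‖ * ‖1 - z‖ ≤ ‖F.eval 1‖ := by
    rw [← hd, ← norm_mul]
    rcases eq_or_ne (1 - z) 0 with h0 | h0
    · simp [h0]
    · have hlt2 : ‖k * (1 - z) ^ 2‖ < ‖(derivative F).eval z * (1 - z)‖ := by
        rw [norm_mul, norm_mul, norm_pow, sq, ← mul_assoc]
        refine mul_lt_mul_of_pos_right ?_ (norm_pos_iff.2 h0)
        exact (mul_le_of_le_one_left (norm_nonneg _) (PadicInt.norm_le_one k)).trans_lt hlt'
      rw [hk', IsUltrametricDist.norm_add_eq_max_of_norm_ne_norm hlt2.ne']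
      exact le_max_left _ _
  have e3 : w * (z : ℚ_[p]) - w = -(w * ((1 - z : ℤ_[p]) : ℚ_[p])) := by push_cast; ring
  rw [e3, e1, e2, norm_neg, norm_mul, norm_mul, norm_mul, ← PadicInt.norm_def, ← PadicInt.norm_def,
    ← PadicInt.norm_def]
  calc _ = ‖w‖ * ‖m‖ * (‖(derivative F).eval 1‖ * ‖1 - z‖) := by ring
    _ ≤ ‖w‖ * ‖m‖ * ‖F.eval 1‖ := by gcongr
    _ = _ := by ring

/-- The quadratic error term in the Taylor expansion. -/
lemma norm_taylor_error_le (hw : w ≠ 0) (h : ‖u - w‖ ≤ ‖w‖) :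
    ‖q.eval u - q.eval w - (derivative q).eval w * (u - w)‖ * ‖w‖ ^ 2 ≤
      gn q ‖w‖ * ‖u - w‖ ^ 2 := by
  obtain ⟨F, m, hm, hF, hF'⟩ := exists_integral_model q hw
  have hw' : 0 < ‖w‖ := norm_pos_iff.2 hw
  let t : ℤ_[p] := ⟨(u - w) / w, by rw [norm_div]; exact (div_le_one hw').2 h⟩
  have ht : (t : ℚ_[p]) = (u - w) / w := rfl
  have hu : u = w * ((1 + t : ℤ_[p]) : ℚ_[p]) := by push_cast; rw [ht]; field_simp; ring
  have e0 := hF (1 + t)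
  have e1 := hF 1
  have e2 := hF' 1
  rw [← hu] at e0
  simp only [PadicInt.coe_one, mul_one] at e1 e2
  obtain ⟨k, hk⟩ := F.binomExpansion 1 t
  rw [hk] at e0
  have e3 : (derivative q).eval w = m * ((derivative F).eval 1 : ℤ_[p]) / w := by
    rw [← e2]; field_simp
  have e4 : u - w = w * t := by rw [ht]; field_simp
  have : q.eval u - q.eval w - (derivative q).eval w * (u - w) = m * (k * t ^ 2) := by
    rw [e0, e1, e3, e4]; push_cast; field_simp; ring
  rw [this, e4, ← hm, norm_mul, norm_mul, norm_mul, norm_pow, mul_pow]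
  have : ‖(k : ℚ_[p])‖ ≤ 1 := k.2
  calc _ ≤ ‖m‖ * (1 * ‖(t : ℚ_[p])‖ ^ 2) * ‖w‖ ^ 2 := by gcongr
    _ = _ := by ring

/-! ### Quantitatively simple roots -/

/-- A nonzero root of `q` at which the linear term of `q` is at least `ε` times all other terms. -/
structure SimpleRoot (ε : ℝ) (q : ℚ_[p][X]) (z : ℚ_[p]) : Prop where
  ne_zero : z ≠ 0
  isRoot : q.eval z = 0
  le : ε * gn q ‖z‖ ≤ ‖z * (derivative q).eval z‖

/-- The linear term stays large when the coefficients and the argument are perturbed. -/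
lemma euler_le_of_rel (hq : q' ≠ 0) (hw0 : w' ≠ 0) (h0 : 0 ≤ δ) (hδε : δ < ε) (hε : ε ≤ 1)
    (h : ∀ i, RvRel δ (q.coeff i) (q'.coeff i)) (hw : RvRel δ w w')
    (hle : ε * gn q' ‖w'‖ ≤ ‖w' * (derivative q').eval w'‖) :
    ε * gn q ‖w‖ ≤ ‖w * (derivative q).eval w‖ := by
  have hδ : δ < 1 := hδε.trans_le hε
  have hw'0 : 0 < ‖w'‖ := norm_pos_iff.2 hw0
  have hg := gn_pos hw'0 hq
  have h1 := norm_eval_sub_eval_le h0 hδ (euler_rel h0 hδ h) hw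
  rw [eval_euler, eval_euler] at h1
  have h2 : ‖w * (derivative q).eval w - w' * (derivative q').eval w'‖ <
      ‖w' * (derivative q').eval w'‖ :=
    calc _ ≤ δ * gn q' ‖w'‖ := h1.trans (by gcongr; exact gn_euler_le hw'0.le)
      _ < ε * gn q' ‖w'‖ := by gcongr
      _ ≤ _ := hle
  have := IsUltrametricDist.norm_add_eq_max_of_norm_ne_norm h2.ne
  rw [sub_add_cancel, max_eq_right h2.le] at this
  rw [this, hw.norm_eq hδ, gn_congr hδ h hw'0.le]
  exact hle

lemma exists_simpleRoot (hq : q ≠ 0) (hw : w ≠ 0) (h0 : 0 ≤ δ) (hδ : δ < ε ^ 2) (h0ε : 0 < ε)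
    (hε : ε ≤ 1) (h : ‖q.eval w‖ ≤ δ * gn q ‖w‖)
    (hle : ε * gn q ‖w‖ ≤ ‖w * (derivative q).eval w‖) :
    ∃ z, SimpleRoot ε q z ∧ RvRel (δ / ε) z w := by
  have hw' := norm_pos_iff.2 hw
  have hg := gn_pos hw' hq
  have hδε : δ / ε < ε := by rw [div_lt_iff₀ h0ε]; nlinarith
  have hlt : ‖q.eval w‖ * gn q ‖w‖ < ‖w * (derivative q).eval w‖ ^ 2 := calc
    _ ≤ δ * gn q ‖w‖ * gn q ‖w‖ := by gcongr
    _ < ε ^ 2 * gn q ‖w‖ * gn q ‖w‖ := by gcongr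
    _ = (ε * gn q ‖w‖) ^ 2 := by ring
    _ ≤ _ := by gcongr
  obtain ⟨z, hz, hzw⟩ := hensel hw hlt
  have hrel : RvRel (δ / ε) z w := by
    have : ‖z - w‖ * (ε * gn q ‖w‖) ≤ δ * gn q ‖w‖ * ‖w‖ :=
      (mul_le_mul_of_nonneg_left hle (norm_nonneg _)).trans (hzw.trans (by gcongr))
    have h3 : ‖z - w‖ * ε * gn q ‖w‖ ≤ δ * ‖w‖ * gn q ‖w‖ := by linarith
    have h4 := le_of_mul_le_mul_right h3 hg
    unfold RvRel
    rw [div_mul_eq_mul_div, le_div_iff₀ h0ε]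
    exact h4
  have h0' : 0 ≤ δ / ε := by positivity
  exact ⟨z, ⟨fun h => hw ((hrel.eq_zero_iff (hδε.trans_le hε)).1 h), hz,
    euler_le_of_rel hq hw h0' hδε hε (fun i => .refl h0' _) hrel hle⟩, hrel⟩

lemma SimpleRoot.transfer (hr : SimpleRoot ε q w) (hq : q ≠ 0) (h0 : 0 ≤ δ) (hδ : δ < ε ^ 2)
    (h0ε : 0 < ε) (hε : ε ≤ 1) (h : ∀ i, RvRel δ (q'.coeff i) (q.coeff i)) :
    ∃ z, SimpleRoot ε q' z ∧ RvRel (δ / ε) z w := by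
  have hδε : δ < ε := by nlinarith
  have hδ1 : δ < 1 := hδε.trans_le hε
  refine exists_simpleRoot ?_ hr.ne_zero h0 hδ h0ε hε ?_
    (euler_le_of_rel hq hr.ne_zero h0 hδε hε h (.refl h0 _) hr.le)
  · rintro rfl
    exact hq (Polynomial.ext fun i => by simpa using ((h i).eq_zero_iff hδ1).1)
  · have := norm_eval_sub_eval_le h0 hδ1 h (RvRel.refl h0 w)
    rwa [hr.isRoot, sub_zero, ← gn_congr hδ1 h (norm_nonneg _)] at this

/-- Newton approximation of a simple root. -/
lemma SimpleRoot.rel_newton (hr : SimpleRoot ε q z) (hq : q ≠ 0) (h0 : 0 < θ) (hθ : θ < ε)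
    (hε : ε ≤ 1) (h : ‖z - u‖ ≤ θ * ‖z‖) :
    RvRel (θ / ε) (-q.eval u / (derivative q).eval u) (z - u) := by
  have h0ε := h0.trans hθ
  have hz := norm_pos_iff.2 hr.ne_zero
  have hrel : RvRel θ u z := by unfold RvRel; rwa [norm_sub_rev]
  have hn := hrel.norm_eq (hθ.trans_le hε)
  have hu : u ≠ 0 := fun h => hr.ne_zero ((hrel.eq_zero_iff (hθ.trans_le hε)).1 h)
  have hu' := norm_pos_iff.2 hu
  have hg := gn_pos hu' hq
  have hle := euler_le_of_rel hq hr.ne_zero h0.le hθ hε (fun i => .refl h0.le _) hrel hr.le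
  have hd : (derivative q).eval u ≠ 0 := by
    intro hd
    rw [hd, mul_zero, norm_zero] at hle
    nlinarith
  have hd' := norm_pos_iff.2 hd
  rw [← hn] at h
  have herr := norm_taylor_error_le (q := q) (u := z) hu (h.trans (by nlinarith))
  rw [hr.isRoot] at herr
  have e : -q.eval u / (derivative q).eval u - (z - u) =
      (0 - q.eval u - (derivative q).eval u * (z - u)) / (derivative q).eval u := by
    field_simp; ring
  unfold RvRel
  rw [e, norm_div, div_le_iff₀ hd', div_mul_eq_mul_div, div_mul_eq_mul_div, le_div_iff₀ h0ε]
  rw [norm_mul] at hle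
  set E := ‖0 - q.eval u - (derivative q).eval u * (z - u)‖
  refine le_of_mul_le_mul_right ?_ (pow_pos hu' 2)
  calc E * ε * ‖u‖ ^ 2 = ε * (E * ‖u‖ ^ 2) := by ring
    _ ≤ ε * (gn q ‖u‖ * ‖z - u‖ ^ 2) := by gcongr
    _ = ε * gn q ‖u‖ * ‖z - u‖ * ‖z - u‖ := by ring
    _ ≤ (‖u‖ * ‖(derivative q).eval u‖) * ‖z - u‖ * (θ * ‖u‖) := by gcongr
    _ = _ := by ring

lemma SimpleRoot.eq (hz : SimpleRoot ε q z) (hw : SimpleRoot ε q w) (hq : q ≠ 0) (h0 : 0 < θ)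
    (hθ : θ < ε) (hε : ε ≤ 1) (h : RvRel θ w z) : z = w := by
  have h' : ‖z - w‖ ≤ θ * ‖z‖ := by rw [norm_sub_rev]; exact h
  have := hz.rel_newton hq h0 hθ hε h'
  rw [hw.isRoot, neg_zero, zero_div] at this
  have h1 := this.eq_zero_iff (by rw [div_lt_one (h0.trans hθ)]; exact hθ)
  exact sub_eq_zero.1 (h1.1 rfl)

/-- Near a simple root `z`, the linear term of the expansion at `z` dominates. -/
lemma SimpleRoot.gn_taylor_le (hr : SimpleRoot ε q z) (hq : q ≠ 0) (h0 : 0 < θ) (hθ : θ < ε)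
    (hε : ε ≤ 1) (h : RvRel θ w z) : ε * gn (taylor z q) ‖w - z‖ ≤ ‖q.eval w‖ := by
  have h0ε := h0.trans hθ
  have hz := norm_pos_iff.2 hr.ne_zero
  have hg := gn_pos hz hq
  have hwz : ‖w - z‖ ≤ ‖z‖ := le_trans h (by nlinarith)
  have herr := norm_taylor_error_le (q := q) (u := w) hr.ne_zero hwz
  rw [hr.isRoot, sub_zero] at herr
  have hle := hr.le
  rw [norm_mul] at hle
  rcases eq_or_ne w z with rfl | hne
  · rw [sub_self, norm_zero, gn_zero_right]
    simp [taylor_coeff_zero, hr.isRoot]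
  have hne' : 0 < ‖w - z‖ := norm_pos_iff.2 (sub_ne_zero.2 hne)
  set d := (derivative q).eval z with hd
  have hlt : ‖q.eval w - d * (w - z)‖ < ‖d * (w - z)‖ := by
    refine lt_of_mul_lt_mul_right (herr.trans_lt ?_) (sq_nonneg ‖z‖)
    rw [norm_mul]
    calc gn q ‖z‖ * ‖w - z‖ ^ 2 = gn q ‖z‖ * ‖w - z‖ * ‖w - z‖ := by ring
      _ ≤ gn q ‖z‖ * ‖w - z‖ * (θ * ‖z‖) := by gcongr; exact h
      _ < gn q ‖z‖ * ‖w - z‖ * (ε * ‖z‖) := by gcongr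
      _ = ε * gn q ‖z‖ * ‖w - z‖ * ‖z‖ := by ring
      _ ≤ ‖z‖ * ‖d‖ * ‖w - z‖ * ‖z‖ := by gcongr
      _ = _ := by ring
  have hn : ‖q.eval w‖ = ‖d‖ * ‖w - z‖ := by
    have := IsUltrametricDist.norm_add_eq_max_of_norm_ne_norm hlt.ne
    rw [sub_add_cancel, max_eq_right hlt.le, norm_mul] at this
    exact this
  obtain ⟨j, hj⟩ := exists_gn_eq (taylor z q) ‖w - z‖
  rw [hj]
  rcases j with _ | j
  · simp [taylor_coeff_zero, hr.isRoot]
  · have hb : ‖(taylor z q).coeff (j + 1)‖ * ‖z‖ ^ (j + 1) ≤ gn q ‖z‖ :=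
      (le_gn hz.le _ _).trans (PadicDefinable.gn_taylor_le le_rfl)
    rw [hn]
    refine le_of_mul_le_mul_right ?_ hz
    calc ε * (‖(taylor z q).coeff (j + 1)‖ * ‖w - z‖ ^ (j + 1)) * ‖z‖
        = ε * (‖(taylor z q).coeff (j + 1)‖ * (‖w - z‖ ^ j * ‖z‖)) * ‖w - z‖ := by ring
      _ ≤ ε * (‖(taylor z q).coeff (j + 1)‖ * (‖z‖ ^ j * ‖z‖)) * ‖w - z‖ := by gcongr
      _ = ε * (‖(taylor z q).coeff (j + 1)‖ * ‖z‖ ^ (j + 1)) * ‖w - z‖ := by ring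
      _ ≤ ε * gn q ‖z‖ * ‖w - z‖ := by gcongr
      _ ≤ ‖z‖ * ‖d‖ * ‖w - z‖ := by gcongr
      _ = _ := by ring

/-- If the derivative is comparable to its largest term, the linear term of `q` controls all
terms but the constant one. -/
lemma small_or_linear {d : ℕ} (hd : q.natDegree ≤ d) (hδ : δ ≤ 1) (h0ε : 0 ≤ ε)
    (h : ε * gn (derivative q) ‖w‖ ≤ ‖(derivative q).eval w‖) :
    δ * gn q ‖w‖ ≤ ‖q.eval w‖ ∨
      (w ≠ 0 ∧ ε * ‖(d.factorial : ℚ_[p])‖ * gn q ‖w‖ ≤ ‖w * (derivative q).eval w‖) := by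
  refine or_iff_not_imp_left.2 fun hlt => ?_
  rw [not_le] at hlt
  have hw : w ≠ 0 := by
    rintro rfl
    rw [norm_zero, gn_zero_right,
      ← coeff_zero_eq_eval_zero] at hlt
    nlinarith [norm_nonneg (q.coeff 0)]
  have hw' := norm_pos_iff.2 hw
  refine ⟨hw, ?_⟩
  have hgn : 0 ≤ gn q ‖w‖ := gn_nonneg hw'.le
  have hpos : ∀ j, 1 ≤ j → ε * ‖(d.factorial : ℚ_[p])‖ * (‖q.coeff j‖ * ‖w‖ ^ j) ≤
      ‖w * (derivative q).eval w‖ := by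
    intro j hj
    rcases lt_or_ge d j with hdj | hdj
    · rw [coeff_eq_zero_of_natDegree_lt (hd.trans_lt hdj), norm_zero, zero_mul, mul_zero]
      exact norm_nonneg _
    obtain ⟨j, rfl⟩ := Nat.exists_eq_add_of_le' hj
    have hfac : ‖(d.factorial : ℚ_[p])‖ ≤ ‖((j + 1 : ℕ) : ℚ_[p])‖ := by
      obtain ⟨k, hk⟩ := Nat.dvd_factorial (Nat.succ_pos j) hdj
      rw [hk, Nat.cast_mul, norm_mul]
      exact mul_le_of_le_one_right (norm_nonneg _) (by exact_mod_cast Padic.norm_int_le_one (k : ℤ))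
    have hc := le_gn hw'.le (derivative q) j
    rw [coeff_derivative, norm_mul] at hc
    push_cast at hfac
    rw [norm_mul]
    calc _ ≤ ε * ‖(j + 1 : ℚ_[p])‖ * (‖q.coeff (j + 1)‖ * ‖w‖ ^ (j + 1)) := by gcongr
      _ = ε * (‖q.coeff (j + 1)‖ * ‖(j + 1 : ℚ_[p])‖ * ‖w‖ ^ j) * ‖w‖ := by ring
      _ ≤ ε * gn (derivative q) ‖w‖ * ‖w‖ := by gcongr
      _ ≤ ‖(derivative q).eval w‖ * ‖w‖ := by gcongr
      _ = _ := mul_comm _ _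
  have hlt' : ‖q.eval w‖ < gn q ‖w‖ := hlt.trans_le (mul_le_of_le_one_left hgn hδ)
  by_contra hcon
  rw [not_le] at hcon
  have hκ : 0 ≤ ε * ‖(d.factorial : ℚ_[p])‖ := by positivity
  have hrest : gn (q - C (q.coeff 0)) ‖w‖ < gn q ‖w‖ := by
    obtain ⟨j, hj⟩ := exists_gn_eq (q - C (q.coeff 0)) ‖w‖
    rw [hj]
    rcases j with _ | j
    · simpa using (norm_nonneg _).trans_lt hlt'
    · rw [coeff_sub, coeff_C_succ, sub_zero]
      exact lt_of_mul_lt_mul_left ((hpos _ (by omega)).trans_lt hcon) hκ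
  obtain ⟨j, hj⟩ := exists_gn_eq q ‖w‖
  rcases j with _ | j
  · rw [pow_zero, mul_one] at hj
    have h1 : ‖q.eval w - q.coeff 0‖ < ‖q.coeff 0‖ := by
      rw [← hj]
      simpa using (norm_eval_le (q - C (q.coeff 0)) w).trans_lt hrest
    have := IsUltrametricDist.norm_add_eq_max_of_norm_ne_norm h1.ne
    rw [sub_add_cancel, max_eq_right h1.le, ← hj] at this
    exact hlt'.ne this
  · rw [hj] at hcon
    exact (hpos _ (by omega)).not_gt hcon

/-! ### The filter of leading-term data -/

section Filter

variable {Ω : Type*}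

/-- The filter on `Ω × Ω` generated by the relations that `a x` and `a y` have the same leading term up
to relative precision `δ`, for `a ∈ A` and `δ > 0`. -/
def rvFilter (A : Subring (Ω → ℚ_[p])) : Filter (Ω × Ω) where
  sets := {W | ∃ s ⊆ (A : Set (Ω → ℚ_[p])), s.Finite ∧ ∃ δ : ℝ, 0 < δ ∧ δ < 1 ∧
    ∀ x y, (∀ a ∈ s, RvRel δ (a x) (a y)) → (x, y) ∈ W}
  univ_sets := ⟨∅, by simp, by simp, 1 / 2, by norm_num, by norm_num, by simp⟩
  sets_of_superset := by
    rintro W W' ⟨s, hs, hf, δ, h0, h1, h⟩ hW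
    exact ⟨s, hs, hf, δ, h0, h1, fun x y hxy => hW (h x y hxy)⟩
  inter_sets := by
    rintro W W' ⟨s, hs, hf, δ, h0, h1, h⟩ ⟨s', hs', hf', δ', h0', h1', h'⟩
    refine ⟨s ∪ s', Set.union_subset hs hs', hf.union hf', min δ δ', lt_min h0 h0',
      (min_le_left _ _).trans_lt h1, fun x y hxy => ⟨h x y fun a ha => ?_, h' x y fun a ha => ?_⟩⟩
    · exact (hxy a (.inl ha)).mono (min_le_left _ _)
    · exact (hxy a (.inr ha)).mono (min_le_right _ _)

variable {A B : Subring (Ω → ℚ_[p])}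

lemma eventually_rvFilter {P : Ω × Ω → Prop} :
    (∀ᶠ q in rvFilter A, P q) ↔ ∃ s ⊆ (A : Set (Ω → ℚ_[p])), s.Finite ∧ ∃ δ : ℝ, 0 < δ ∧ δ < 1 ∧
      ∀ x y, (∀ a ∈ s, RvRel δ (a x) (a y)) → P (x, y) := Iff.rfl

/-- The leading terms of `h` are determined along `l`, to any precision. -/
def IsFine (l : Filter (Ω × Ω)) (h : Ω → ℚ_[p]) : Prop :=
  ∀ ε : ℝ, 0 < ε → ∀ᶠ q in l, RvRel ε (h q.1) (h q.2)

lemma isFine_of_mem {a : Ω → ℚ_[p]} (ha : a ∈ A) : IsFine (rvFilter A) a := by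
  intro ε hε
  refine eventually_rvFilter.2 ⟨{a}, by simpa using ha, by simp, min ε (1 / 2),
    lt_min hε (by norm_num), (min_le_right _ _).trans_lt (by norm_num), fun x y h => ?_⟩
  exact (h a rfl).mono (min_le_left _ _)

lemma le_rvFilter {l : Filter (Ω × Ω)} (h : ∀ a ∈ A, IsFine l a) : l ≤ rvFilter A := by
  rintro W ⟨s, hs, hf, δ, h0, -, hW⟩
  filter_upwards [(Filter.eventually_all_finite hf).2 fun a ha => h a (hs ha) δ h0] with q hq
  exact hW _ _ hq

lemma eventually_swap {P : Ω × Ω → Prop} (h : ∀ᶠ q in rvFilter A, P q) :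
    ∀ᶠ q in rvFilter A, P q.swap := by
  obtain ⟨s, hs, hf, δ, h0, h1, h⟩ := eventually_rvFilter.1 h
  exact eventually_rvFilter.2
    ⟨s, hs, hf, δ, h0, h1, fun x y hxy => h y x fun a ha => (hxy a ha).symm h1⟩

/-- One can choose representatives of the leading-term classes. -/
lemma exists_representative {P : Ω × Ω → Prop} (h : ∀ᶠ q in rvFilter A, P q) :
    ∃ rep : Ω → Ω, (∀ x, P (rep x, x)) ∧ ∀ᶠ q in rvFilter A, rep q.1 = rep q.2 := by
  obtain ⟨s, hs, hf, δ, h0, h1, h⟩ := eventually_rvFilter.1 h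
  let S : Setoid Ω :=
    { r := fun x y => ∀ a ∈ s, RvRel δ (a x) (a y)
      iseqv := ⟨fun x a _ => .refl h0.le _, fun hxy a ha => (hxy a ha).symm h1,
        fun hxy hyz a ha => (hxy a ha).trans (hyz a ha) h1⟩ }
  refine ⟨fun x => (Quotient.mk S x).out,
    fun x => h _ _ (Quotient.exact (s := S) (Quotient.out_eq (Quotient.mk S x))),
    eventually_rvFilter.2 ⟨s, hs, hf, δ, h0, h1, fun x y hxy => ?_⟩⟩
  exact congrArg Quotient.out (Quotient.sound (s := S) hxy)

/-- The subring `B` contains every function all of whose polynomial expressions over `B` have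
leading terms determined by those of elements of `B`. -/
def IsRvClosed (B : Subring (Ω → ℚ_[p])) : Prop :=
  ∀ h : Ω → ℚ_[p], (∀ P : B[X], IsFine (rvFilter B) (P.eval₂ B.subtype h)) → h ∈ B

lemma exists_isRvClosed (A : Subring (Ω → ℚ_[p])) :
    ∃ B, A ≤ B ∧ rvFilter A ≤ rvFilter B ∧ IsRvClosed B := by
  obtain ⟨B, hAB, hB⟩ := zorn_le_nonempty₀
    {B | A ≤ B ∧ rvFilter A ≤ rvFilter B} (fun c hc hch B hBc => by
    have hdir := hch.directedOn
    refine ⟨sSup c, ⟨(hc hBc).1.trans (le_sSup hBc), le_rvFilter fun a ha => ?_⟩,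
      fun z hz => le_sSup hz⟩
    obtain ⟨D, hD, haD⟩ := (Subring.mem_sSup_of_directedOn ⟨B, hBc⟩ hdir).1 ha
    exact fun ε hε => (hc hD).2 (isFine_of_mem haD ε hε)) A ⟨le_rfl, le_rfl⟩
  refine ⟨B, hAB, hB.prop.2, fun h hh => ?_⟩
  let φ := eval₂RingHom B.subtype h
  have hBφ : B ≤ φ.range := fun b hb => ⟨C ⟨b, hb⟩, by simp [φ]⟩
  have hφ : rvFilter B ≤ rvFilter φ.range := le_rvFilter (by
    rintro _ ⟨P, rfl⟩
    exact hh P)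
  exact hB.2 ⟨hAB.trans hBφ, hB.prop.2.trans hφ⟩ hBφ ⟨X, by simp [φ]⟩

/-- The specialization at `x` of a polynomial with coefficients in a ring of functions. -/
noncomputable def spec (x : Ω) (P : B[X]) : ℚ_[p][X] :=
  P.map ((Pi.evalRingHom (fun _ : Ω => ℚ_[p]) x).comp B.subtype)

lemma coeff_spec (x : Ω) (P : B[X]) (i : ℕ) :
    (spec x P).coeff i = (P.coeff i : Ω → ℚ_[p]) x := by simp [spec]

lemma eval_spec (x : Ω) (P : B[X]) (h : Ω → ℚ_[p]) :
    (spec x P).eval (h x) = P.eval₂ B.subtype h x := by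
  rw [spec, eval_map]
  exact (hom_eval₂ P B.subtype (Pi.evalRingHom (fun _ : Ω => ℚ_[p]) x) h).symm

lemma spec_taylor (x : Ω) (c : B) (P : B[X]) :
    spec x (taylor c P) = taylor ((c : Ω → ℚ_[p]) x) (spec x P) := by
  rw [spec, spec, taylor_apply, taylor_apply, Polynomial.map_comp]
  simp

lemma derivative_spec (x : Ω) (P : B[X]) : derivative (spec x P) = spec x (derivative P) :=
  derivative_map ..

lemma eventually_coeff_spec (P : B[X]) (hε : 0 < ε) :
    ∀ᶠ q in rvFilter B, ∀ i, RvRel ε ((spec q.1 P).coeff i) ((spec q.2 P).coeff i) := by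
  have : ∀ᶠ q in rvFilter B, ∀ i ∈ Finset.range (P.natDegree + 1),
      RvRel ε ((spec q.1 P).coeff i) ((spec q.2 P).coeff i) := by
    refine (Filter.eventually_all_finset _).2 fun i _ => ?_
    simp only [coeff_spec]
    exact isFine_of_mem (P.coeff i).2 ε hε
  filter_upwards [this] with q hq i
  by_cases hi : i ∈ Finset.range (P.natDegree + 1)
  · exact hq i hi
  · rw [coeff_spec, coeff_spec, coeff_eq_zero_of_natDegree_lt (by simpa using hi)]
    exact .refl hε.le _

lemma IsRvClosed.inv_mem (hB : IsRvClosed B) {b : Ω → ℚ_[p]} (hb : b ∈ B) : b⁻¹ ∈ B := by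
  refine hB _ fun P ε hε => ?_
  have h1 : P.reverse.eval₂ B.subtype b ∈ B := by
    rw [show b = B.subtype ⟨b, hb⟩ from rfl, eval₂_at_apply]
    exact Subtype.property _
  have h2 : b ^ P.natDegree ∈ B := pow_mem hb _
  have hε' : 0 < min ε (1 / 2) := lt_min hε (by norm_num)
  have hε1 : min ε (1 / 2) < 1 := (min_le_right _ _).trans_lt (by norm_num)
  filter_upwards [isFine_of_mem h1 _ hε', isFine_of_mem h2 _ hε', isFine_of_mem hb _ hε',
    isFine_of_mem (P.coeff 0).2 ε hε] with q q1 q2 q3 q4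
  have key0 : ∀ x, b x = 0 → P.eval₂ B.subtype b⁻¹ x = (P.coeff 0 : Ω → ℚ_[p]) x := by
    intro x h
    rw [← eval_spec, Pi.inv_apply, h, inv_zero, ← coeff_zero_eq_eval_zero, coeff_spec]
  have key1 : ∀ x, b x ≠ 0 → P.eval₂ B.subtype b⁻¹ x =
      P.reverse.eval₂ B.subtype b x / (b ^ P.natDegree) x := by
    intro x h
    let _ := invertibleOfNonzero (inv_ne_zero h)
    have := eval₂_reverse_mul_pow
      ((Pi.evalRingHom (fun _ : Ω => ℚ_[p]) x).comp B.subtype) (b x)⁻¹ P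
    rw [invOf_eq_inv, inv_inv] at this
    rw [← eval_spec, ← eval_spec, spec, spec, eval_map, eval_map, Pi.inv_apply, ← this,
      Pi.pow_apply, inv_pow, div_eq_mul_inv]
  by_cases h : b q.2 = 0
  · rw [key0 _ h, key0 _ ((q3.eq_zero_iff hε1).2 h)]
    exact q4
  · rw [key1 _ h, key1 _ (mt (q3.eq_zero_iff hε1).1 h)]
    exact (q1.div q2 hε1).mono (min_le_left _ _)

end Filter

/-! ### Preparation of polynomials over closed rings of functions -/

section Preparation

variable {Ω : Type*} {A B : Subring (Ω → ℚ_[p])}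

lemma eval_spec_taylor (x : Ω) (c : B) (P : B[X]) (y : ℚ_[p]) :
    (spec x (taylor c P)).eval (y - (c : Ω → ℚ_[p]) x) = (spec x P).eval y := by
  rw [spec_taylor, taylor_eval, sub_add_cancel]

lemma spec_ne_zero {Q : B[X]} (hQ : Q.Monic) (x : Ω) : spec x Q ≠ 0 := (hQ.map _).ne_zero

lemma eval₂_mem {b : Ω → ℚ_[p]} (hb : b ∈ B) (P : B[X]) : P.eval₂ B.subtype b ∈ B := by
  rw [show b = B.subtype ⟨b, hb⟩ from rfl, eval₂_at_apply]
  exact Subtype.property _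

lemma gn_C_mul (hr : 0 ≤ r) (k : ℚ_[p]) (q : ℚ_[p][X]) : gn (C k * q) r = ‖k‖ * gn q r := by
  refine le_antisymm (gn_le fun i => ?_) ?_
  · rw [coeff_C_mul, norm_mul, mul_assoc]
    exact mul_le_mul_of_nonneg_left (le_gn hr q i) (norm_nonneg _)
  · obtain ⟨i, hi⟩ := exists_gn_eq q r
    rw [hi, ← mul_assoc, ← norm_mul, ← coeff_C_mul]
    exact le_gn hr _ i

/-- The norm of `R` at a point is comparable to the Gauss norm of its expansion around one of
finitely many centers. -/
def IsPrepared (R : B[X]) : Prop :=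
  ∃ S : Set B, S.Finite ∧ ∃ ε : ℝ, 0 < ε ∧ ∀ (x : Ω) (y : ℚ_[p]), ∃ c ∈ S,
    ε * gn (spec x (taylor c R)) ‖y - (c : Ω → ℚ_[p]) x‖ ≤ ‖(spec x R).eval y‖

/-- The leading term of `R` at a point is determined by those of the differences with finitely
many centers. -/
lemma IsPrepared.rel {R : B[X]} (hR : IsPrepared R) {η : ℝ} (hη : 0 < η) :
    ∃ S : Set B, S.Finite ∧ ∃ δ : ℝ, 0 < δ ∧ δ < 1 ∧ ∀ᶠ q in rvFilter B, ∀ y y' : ℚ_[p],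
      (∀ c ∈ S, RvRel δ (y - (c : Ω → ℚ_[p]) q.1) (y' - (c : Ω → ℚ_[p]) q.2)) →
        RvRel η ((spec q.1 R).eval y) ((spec q.2 R).eval y') := by
  obtain ⟨S, hS, ε, hε, h⟩ := hR
  have hδ : 0 < min (η * ε) (1 / 2) := lt_min (by positivity) (by norm_num)
  have hδ1 : min (η * ε) (1 / 2) < 1 := (min_le_right _ _).trans_lt (by norm_num)
  refine ⟨S, hS, _, hδ, hδ1, ?_⟩
  filter_upwards [(Filter.eventually_all_finite hS).2 fun c _ =>
    eventually_coeff_spec (taylor c R) hδ] with q hq y y' hy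
  obtain ⟨c, hc, hle⟩ := h q.2 y'
  rw [← eval_spec_taylor q.1 c, ← eval_spec_taylor q.2 c]
  rw [← eval_spec_taylor q.2 c] at hle
  refine (norm_eval_sub_eval_le hδ.le hδ1 (hq c hc) (hy c hc)).trans ?_
  calc _ ≤ η * ε * gn (spec q.2 (taylor c R)) ‖y' - (c : Ω → ℚ_[p]) q.2‖ :=
        mul_le_mul_of_nonneg_right (min_le_left _ _) (gn_nonneg (norm_nonneg _))
    _ ≤ _ := by rw [mul_assoc]; exact mul_le_mul_of_nonneg_left hle hη.le

lemma isPrepared_of_natDegree_eq_zero {R : B[X]} (hR : R.natDegree = 0) : IsPrepared R := by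
  refine ⟨{0}, by simp, 1, one_pos, fun x y => ⟨0, rfl, ?_⟩⟩
  rw [eq_C_of_natDegree_eq_zero hR, taylor_C, one_mul]
  refine gn_le fun i => ?_
  rcases i with _ | i
  · simp [spec]
  · simp [spec]

lemma norm_sub_le_max (u v : ℚ_[p]) : ‖u - v‖ ≤ max ‖u‖ ‖v‖ := by
  rw [sub_eq_add_neg, ← norm_neg v]; exact IsUltrametricDist.norm_add_le_max _ _

/-- Along the filter of a closed ring, a simple root with a determined leading term differs from
elements of the ring by functions with determined leading terms. -/
lemma isFine_sub_of_simpleRoot {Q : B[X]} (hQ : Q.Monic) {g e : Ω → ℚ_[p]}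
    (hg : IsFine (rvFilter B) g) (he : e ∈ B) (h0 : 0 < ε) (h1 : ε ≤ 1)
    (hroot : ∀ x, g x = 0 ∨ SimpleRoot ε (spec x Q) (g x)) : IsFine (rvFilter B) (g - e) := by
  intro η' hη'
  obtain ⟨η, hη, hη1, hle⟩ : ∃ η : ℝ, 0 < η ∧ η < 1 ∧ η ≤ η' :=
    ⟨min η' (1 / 2), lt_min hη' (by norm_num), (min_le_right _ _).trans_lt (by norm_num),
      min_le_left _ _⟩
  obtain ⟨θ, hθ, hθε, hθη⟩ : ∃ θ : ℝ, 0 < θ ∧ θ < ε ∧ θ / ε ≤ η :=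
    ⟨ε * η, by positivity, by nlinarith, (by rw [mul_div_cancel_left₀ _ h0.ne'])⟩
  have hκ : 0 < θ * η := by positivity
  have hκθ : θ * η ≤ θ := by nlinarith
  have hκη : θ * η ≤ η := by nlinarith
  have hκ1 : θ * η < 1 := by linarith
  filter_upwards [hg _ hκ, isFine_of_mem he _ hκ, isFine_of_mem (eval₂_mem he Q) _ hη,
    isFine_of_mem (eval₂_mem he (derivative Q)) _ hη] with ⟨x, y⟩ hgq heq hQq hQq'
  simp only [Pi.sub_apply] at *
  refine RvRel.mono ?_ hle
  by_cases hy : g y = 0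
  · rw [hy, (hgq.eq_zero_iff hκ1).2 hy, zero_sub, zero_sub]
    exact (heq.mono hκη).neg
  have hx : g x ≠ 0 := mt (hgq.eq_zero_iff hκ1).1 hy
  have hdiff : ‖(g x - e x) - (g y - e y)‖ ≤ θ * η * max ‖g y‖ ‖e y‖ := by
    rw [sub_sub_sub_comm]
    refine (norm_sub_le_max _ _).trans (max_le ?_ ?_)
    · exact le_trans hgq (mul_le_mul_of_nonneg_left (le_max_left _ _) hκ.le)
    · exact le_trans heq (mul_le_mul_of_nonneg_left (le_max_right _ _) hκ.le)
  rcases le_total (θ * ‖g y‖) ‖g y - e y‖ with hfar | hnear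
  · refine hdiff.trans ?_
    have hey : θ * ‖e y‖ ≤ ‖g y - e y‖ := by
      have : ‖e y‖ ≤ max ‖g y‖ ‖g y - e y‖ := by
        simpa using norm_sub_le_max (g y) (g y - e y)
      rcases le_max_iff.1 this with h | h
      · exact (mul_le_mul_of_nonneg_left h hθ.le).trans hfar
      · exact (mul_le_mul_of_nonneg_left h hθ.le).trans
          (mul_le_of_le_one_left (norm_nonneg _) (by linarith))
    rw [mul_comm θ η, mul_assoc]
    refine mul_le_mul_of_nonneg_left ?_ hη.le
    rw [mul_max_of_nonneg _ _ hθ.le]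
    exact max_le hfar hey
  · have hrel : RvRel θ (e y) (g y) := by unfold RvRel; rwa [norm_sub_rev]
    have hnear' : ‖g x - e x‖ ≤ θ * ‖g x‖ := by
      rw [hgq.norm_eq hκ1, ← sub_add_cancel (g x - e x) (g y - e y)]
      refine (IsUltrametricDist.norm_add_le_max _ _).trans (max_le (hdiff.trans ?_) hnear)
      rw [hrel.norm_eq (by linarith), max_self]
      exact mul_le_mul_of_nonneg_right hκθ (norm_nonneg _)
    have n1 := ((hroot x).resolve_left hx).rel_newton (spec_ne_zero hQ x) hθ hθε h1 hnear'
    have n2 := ((hroot y).resolve_left hy).rel_newton (spec_ne_zero hQ y) hθ hθε h1 hnear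
    rw [derivative_spec, eval_spec, eval_spec] at n1 n2
    exact (((n1.mono hθη).symm hη1).trans (hQq.neg.div hQq' hη1) hη1).trans (n2.mono hθη) hη1

lemma IsRvClosed.mem_of_simpleRoot (hB : IsRvClosed B) {Q : B[X]} (hQ : Q.Monic)
    (hprep : ∀ R : B[X], R.natDegree < Q.natDegree → IsPrepared R) {g : Ω → ℚ_[p]}
    (hg : IsFine (rvFilter B) g) (h0 : 0 < ε) (h1 : ε ≤ 1)
    (hroot : ∀ x, g x = 0 ∨ SimpleRoot ε (spec x Q) (g x)) : g ∈ B := by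
  by_cases hQ1 : Q = 1
  · have : g = 0 := funext fun x => (hroot x).resolve_right fun h => by
      simpa [hQ1, spec] using h.isRoot
    rw [this]; exact zero_mem B
  refine hB g fun P η hη => ?_
  have hlow : ∀ R : B[X], R.natDegree < Q.natDegree →
      IsFine (rvFilter B) (R.eval₂ B.subtype g) := by
    intro R hR η hη
    obtain ⟨S, hS, δ, hδ, -, h⟩ := (hprep R hR).rel hη
    filter_upwards [h, (Filter.eventually_all_finite hS).2 fun c _ =>
      isFine_sub_of_simpleRoot hQ hg c.2 h0 h1 hroot δ hδ] with q hq hq'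
    rw [← eval_spec, ← eval_spec]
    exact hq _ _ hq'
  have key0 : ∀ x, g x = 0 → P.eval₂ B.subtype g x = (P.coeff 0 : Ω → ℚ_[p]) x := by
    intro x h
    rw [← eval_spec, h, ← coeff_zero_eq_eval_zero, coeff_spec]
  have key1 : ∀ x, g x ≠ 0 → P.eval₂ B.subtype g x = (P %ₘ Q).eval₂ B.subtype g x := by
    intro x h
    have hr := ((hroot x).resolve_left h).isRoot
    rw [← eval_spec, ← eval_spec]
    conv_lhs => rw [← modByMonic_add_div P Q]
    unfold spec at *
    rw [Polynomial.map_add, Polynomial.map_mul, eval_add, eval_mul, hr, zero_mul, add_zero]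
  have hη0 : 0 < min η (1 / 2) := lt_min hη (by norm_num)
  filter_upwards [hg (1 / 2) (by norm_num), isFine_of_mem (P.coeff 0).2 η hη,
    hlow _ (natDegree_modByMonic_lt P hQ hQ1) η hη] with q h1 h2 h3
  by_cases h : g q.2 = 0
  · rw [key0 _ h, key0 _ ((h1.eq_zero_iff (by norm_num)).2 h)]; exact h2
  · rw [key1 _ h, key1 _ (mt (h1.eq_zero_iff (by norm_num)).1 h)]; exact h3

/-- The simple roots of a monic polynomial over a closed ring are covered by finitely many elements
of the ring. -/
lemma IsRvClosed.exists_roots (hB : IsRvClosed B) {Q : B[X]} (hQ : Q.Monic)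
    (hprep : ∀ R : B[X], R.natDegree < Q.natDegree → IsPrepared R) (h0 : 0 < ε) (h1 : ε ≤ 1) :
    ∃ G : Set B, G.Finite ∧ ∀ x z, SimpleRoot ε (spec x Q) z →
      ∃ g ∈ G, (g : Ω → ℚ_[p]) x = z := by
  classical
  have hδ0 : 0 < ε ^ 2 / 2 := by positivity
  have hδε : ε ^ 2 / 2 < ε ^ 2 := by linarith
  have hθ : ε ^ 2 / 2 / ε = ε / 2 := by field_simp
  have hθε : ε / 2 < ε := by linarith
  have hθ0 : 0 < ε / 2 := by linarith
  have hθ1 : ε / 2 < 1 := by linarith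
  obtain ⟨rep, hrep, hrep'⟩ := exists_representative (eventually_coeff_spec Q hδ0)
  let v : ℕ → Ω → ℚ_[p] := fun i x => (spec (rep x) Q).roots.toList.getD i 0
  let near : ℕ → Ω → ℚ_[p] → Prop := fun i x z =>
    SimpleRoot ε (spec x Q) z ∧ RvRel (ε / 2) z (v i x)
  let g : ℕ → Ω → ℚ_[p] := fun i x => if h : ∃ z, near i x z then h.choose else 0
  have hg : ∀ i x z, near i x z → g i x = z := by
    intro i x z hz
    have h : ∃ z, near i x z := ⟨z, hz⟩
    have : g i x = h.choose := dif_pos h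
    rw [this]
    exact h.choose_spec.1.eq hz.1 (spec_ne_zero hQ x) hθ0 hθε h1
      (hz.2.trans (h.choose_spec.2.symm hθ1) hθ1)
  have hg0 : ∀ i x, (¬ ∃ z, near i x z) → g i x = 0 := fun i x h => dif_neg h
  have hmem : ∀ i, g i ∈ B := by
    refine fun i => hB.mem_of_simpleRoot hQ hprep ?_ h0 h1 fun x => ?_
    · intro η hη
      set η' := min η (ε / 2)
      have hη' : 0 < η' := lt_min hη hθ0
      have hη'θ : η' ≤ ε / 2 := min_le_right _ _
      have e1 : η' * ε / 2 / ε ≤ η' := by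
        rw [div_div, div_le_iff₀ (by positivity)]; nlinarith
      have e2 : η' * ε / 2 < ε ^ 2 := by nlinarith
      have e3 : η' * ε / 2 < 1 := by nlinarith
      have e0 : 0 < η' * ε / 2 := by positivity
      have tr : ∀ x y, rep x = rep y →
          (∀ j, RvRel (η' * ε / 2) ((spec x Q).coeff j) ((spec y Q).coeff j)) →
          ∀ z, near i y z → ∃ z', near i x z' ∧ RvRel η' z' z := by
        intro x y hxy hc z hz
        obtain ⟨z', hz', hzz⟩ := hz.1.transfer (spec_ne_zero hQ y) e0.le e2 h0 h1 hc
        have hzz' := hzz.mono e1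
        refine ⟨z', ⟨hz', ?_⟩, hzz'⟩
        have hv : v i x = v i y := by simp only [v, hxy]
        rw [hv]
        exact (hzz'.mono hη'θ).trans hz.2 hθ1
      filter_upwards [hrep', eventually_coeff_spec Q e0] with ⟨x, y⟩ hxy hc
      simp only at hxy hc ⊢
      by_cases h : ∃ z, near i y z
      · obtain ⟨z, hz⟩ := h
        obtain ⟨z', hz', hzz⟩ := tr x y hxy hc z hz
        rw [hg i x z' hz', hg i y z hz]
        exact hzz.mono (min_le_left _ _)
      · rw [hg0 i y h, hg0 i x fun ⟨z, hz⟩ => h ?_]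
        · exact .refl hη.le _
        · obtain ⟨z', hz', -⟩ := tr y x hxy.symm (fun j => (hc j).symm e3) z hz
          exact ⟨z', hz'⟩
    · by_cases h : ∃ z, near i x z
      · obtain ⟨z, hz⟩ := h
        exact .inr (hg i x z hz ▸ hz.1)
      · exact .inl (hg0 i x h)
  refine ⟨(fun i => (⟨g i, hmem i⟩ : B)) '' (Set.Iio Q.natDegree), (Set.finite_Iio _).image _,
    fun x z hz => ?_⟩
  obtain ⟨z', hz', hzz⟩ := hz.transfer (spec_ne_zero hQ x) hδ0.le hδε h0 h1 (hrep x)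
  rw [hθ] at hzz
  have hroots : z' ∈ (spec (rep x) Q).roots.toList := by
    rw [Multiset.mem_toList, mem_roots (spec_ne_zero hQ _)]
    exact hz'.isRoot
  obtain ⟨i, hi, hiz⟩ := List.getElem_of_mem hroots
  have hcard : i < Q.natDegree := by
    rw [Multiset.length_toList] at hi
    exact hi.trans_le ((card_roots' _).trans natDegree_map_le)
  refine ⟨_, ⟨i, hcard, rfl⟩, hg i x z ⟨hz, ?_⟩⟩
  have hv : v i x = z' := by
    simp only [v]; rw [List.getD_eq_getElem _ _ hi, hiz]
  rw [hv]
  exact hzz.symm hθ1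

lemma derivative_taylor_eq {R : Type*} [CommRing R] (c : R) (P : R[X]) :
    derivative (taylor c P) = taylor c (derivative P) := by
  simp [taylor_apply, derivative_comp]

lemma IsRvClosed.isPrepared_of_monic (hB : IsRvClosed B) {Q : B[X]} (hQ : Q.Monic)
    (hprep : ∀ R : B[X], R.natDegree < Q.natDegree → IsPrepared R) : IsPrepared Q := by
  by_cases hd : Q.natDegree = 0
  · exact isPrepared_of_natDegree_eq_zero hd
  obtain ⟨S, hS, ε', hε', h⟩ := hprep _ (natDegree_derivative_lt hd)
  set ε₁ := min ε' 1
  have hε₁ : 0 < ε₁ := lt_min hε' one_pos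
  have hf0 : 0 < ‖(Q.natDegree.factorial : ℚ_[p])‖ :=
    norm_pos_iff.2 (Nat.cast_ne_zero.2 (Nat.factorial_ne_zero _))
  have hf1 : ‖(Q.natDegree.factorial : ℚ_[p])‖ ≤ 1 := by
    exact_mod_cast Padic.norm_int_le_one (Q.natDegree.factorial : ℤ)
  set ε := ε₁ * ‖(Q.natDegree.factorial : ℚ_[p])‖
  have h0 : 0 < ε := by positivity
  have h1 : ε ≤ 1 := mul_le_one₀ (min_le_right _ _) hf0.le hf1
  have hδ0 : 0 < ε ^ 2 / 2 := by positivity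
  have hδε : ε ^ 2 / 2 < ε ^ 2 := by linarith
  have hθ : ε ^ 2 / 2 / ε = ε / 2 := by field_simp
  have hδle : ε ^ 2 / 2 ≤ ε := by nlinarith
  have hmonic : ∀ c, (taylor c Q).Monic := fun c => (leadingCoeff_taylor ..).trans hQ
  choose G hGf hG using fun c : B => hB.exists_roots (hmonic c)
    (fun R hR => hprep R (by rwa [natDegree_taylor] at hR)) h0 h1
  refine ⟨S ∪ ⋃ c ∈ S, (fun g => g + c) '' G c,
    hS.union (hS.biUnion fun c _ => (hGf c).image _), _, hδ0, fun x y => ?_⟩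
  obtain ⟨c, hc, hle⟩ := h x y
  set w := y - (c : Ω → ℚ_[p]) x
  have hle' : ε₁ * gn (derivative (spec x (taylor c Q))) ‖w‖ ≤
      ‖(derivative (spec x (taylor c Q))).eval w‖ := by
    rw [derivative_spec, derivative_taylor_eq, eval_spec_taylor]
    exact (mul_le_mul_of_nonneg_right (min_le_left _ _) (gn_nonneg (norm_nonneg _))).trans hle
  by_cases hbig : ε ^ 2 / 2 * gn (spec x (taylor c Q)) ‖w‖ ≤ ‖(spec x (taylor c Q)).eval w‖
  · refine ⟨c, .inl hc, ?_⟩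
    rwa [eval_spec_taylor] at hbig
  have hdeg : (spec x (taylor c Q)).natDegree ≤ Q.natDegree :=
    natDegree_map_le.trans (natDegree_taylor ..).le
  obtain ⟨hw, hlin⟩ := (small_or_linear hdeg (by linarith) hε₁.le hle').resolve_left hbig
  have hne := spec_ne_zero (hmonic c) x
  obtain ⟨z, hz, hzw⟩ := exists_simpleRoot hne hw hδ0.le hδε h0 h1 (not_le.1 hbig).le hlin
  obtain ⟨g, hg, rfl⟩ := hG c x z hz
  rw [hθ] at hzw
  refine ⟨g + c, .inr (Set.mem_biUnion hc ⟨g, hg, rfl⟩), ?_⟩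
  have := hz.gn_taylor_le hne (half_pos h0) (half_lt_self h0) h1 (hzw.symm (by linarith))
  rw [eval_spec_taylor, ← spec_taylor, taylor_taylor] at this
  have e : y - ((g + c : B) : Ω → ℚ_[p]) x = w - (g : Ω → ℚ_[p]) x := by
    simp only [Subring.coe_add, Pi.add_apply, w]; ring
  rw [e]
  exact (mul_le_mul_of_nonneg_right hδle (gn_nonneg (norm_nonneg _))).trans this

theorem IsRvClosed.isPrepared (hB : IsRvClosed B) (R : B[X]) : IsPrepared R := by
  induction hn : R.natDegree using Nat.strong_induction_on generalizing R with
  | _ n ih =>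
  by_cases h0 : n = 0
  · exact isPrepared_of_natDegree_eq_zero (hn.trans h0)
  have hR : R ≠ 0 := by rintro rfl; exact h0 (by simpa using hn.symm)
  let a : B := R.leadingCoeff
  let b : B := ⟨(a : Ω → ℚ_[p])⁻¹, hB.inv_mem a.2⟩
  let T : B[X] := b • R.eraseLead
  have hT : T.degree < n := by
    refine (degree_smul_le _ _).trans_lt ((degree_eraseLead_lt hR).trans_le ?_)
    rw [← hn]; exact degree_le_natDegree
  obtain ⟨S, hS, ε, hε, h⟩ := hB.isPrepared_of_monic (monic_X_pow_add hT) fun R' hR' =>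
    ih _ (hR'.trans_le (natDegree_le_of_degree_le
      ((degree_add_le _ _).trans (max_le (degree_X_pow_le n) hT.le)))) R' rfl
  obtain ⟨S', hS', ε', hε', h'⟩ := ih _ (show R.eraseLead.natDegree < n from
    (eraseLead_natDegree_le R).trans_lt (by omega)) _ rfl
  refine ⟨S ∪ S', hS.union hS', min ε ε', lt_min hε hε', fun x y => ?_⟩
  have hspec : spec x R = spec x R.eraseLead + C ((a : Ω → ℚ_[p]) x) * X ^ n := by
    conv_lhs => rw [← eraseLead_add_C_mul_X_pow R]
    simp [spec, hn, a]
  by_cases hax : (a : Ω → ℚ_[p]) x = 0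
  · obtain ⟨c, hc, hle⟩ := h' x y
    rw [hax, C_0, zero_mul, add_zero] at hspec
    refine ⟨c, .inr hc, ?_⟩
    rw [spec_taylor, hspec, ← spec_taylor]
    exact (mul_le_mul_of_nonneg_right (min_le_right _ _) (gn_nonneg (norm_nonneg _))).trans hle
  · obtain ⟨c, hc, hle⟩ := h x y
    have hspec' : spec x R = C ((a : Ω → ℚ_[p]) x) * spec x (X ^ n + T) := by
      have hb : (b : Ω → ℚ_[p]) x = ((a : Ω → ℚ_[p]) x)⁻¹ := rfl
      have hC : C ((a : Ω → ℚ_[p]) x) * C ((b : Ω → ℚ_[p]) x) = (1 : ℚ_[p][X]) := by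
        rw [← C_mul, hb, mul_inv_cancel₀ hax, C_1]
      have : spec x (X ^ n + T) = X ^ n + C ((b : Ω → ℚ_[p]) x) * spec x R.eraseLead := by
        simp [spec, T, smul_eq_C_mul]
      rw [hspec, this, mul_add, ← mul_assoc, hC, one_mul, add_comm]
    refine ⟨c, .inl hc, ?_⟩
    rw [spec_taylor, hspec', taylor_mul, taylor_C, ← spec_taylor, gn_C_mul (norm_nonneg _),
      eval_mul, eval_C, norm_mul, mul_left_comm]
    refine mul_le_mul_of_nonneg_left ?_ (norm_nonneg _)
    exact (mul_le_mul_of_nonneg_right (min_le_left _ _) (gn_nonneg (norm_nonneg _))).trans hle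

end Preparation

/-! ### Elimination of quantifiers -/

section Elimination

open FirstOrder Language

variable {Ω : Type*} {A B : Subring (Ω → ℚ_[p])}

lemma exists_finite_centers (hB : IsRvClosed B) {s : Set B[X]} (hs : s.Finite) {η : ℝ}
    (hη : 0 < η) : ∃ S : Set B, S.Finite ∧ ∃ δ : ℝ, 0 < δ ∧ δ < 1 ∧ ∀ᶠ q in rvFilter B,
      ∀ y y' : ℚ_[p], (∀ c ∈ S, RvRel δ (y - (c : Ω → ℚ_[p]) q.1) (y' - (c : Ω → ℚ_[p]) q.2)) →
        ∀ R ∈ s, RvRel η ((spec q.1 R).eval y) ((spec q.2 R).eval y') := by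
  induction s, hs using Set.Finite.induction_on with
  | empty => exact ⟨∅, by simp, 1 / 2, by norm_num, by norm_num, by simp⟩
  | @insert R s _ _ ih =>
    obtain ⟨S, hS, δ, h0, h1, h⟩ := ih
    obtain ⟨S', hS', δ', h0', h1', h'⟩ := (hB.isPrepared R).rel hη
    refine ⟨S ∪ S', hS.union hS', min δ δ', lt_min h0 h0', (min_le_left _ _).trans_lt h1, ?_⟩
    filter_upwards [h, h'] with q hq hq' y y' hy
    refine Set.forall_mem_insert.2 ⟨hq' y y' fun c hc => ?_, hq y y' fun c hc => ?_⟩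
    · exact (hy c (.inr hc)).mono (min_le_right _ _)
    · exact (hy c (.inl hc)).mono (min_le_left _ _)

/-- A point over `x` can be transported to a point over `x'` without changing the leading terms of
the differences with finitely many centers. -/
lemma eventually_exists_point {S : Set B} (hS : S.Finite) (h0 : 0 < δ) (h1 : δ < 1) :
    ∀ᶠ q in rvFilter B, ∀ y : ℚ_[p], ∃ y' : ℚ_[p], ∀ c ∈ S,
      RvRel δ (y - (c : Ω → ℚ_[p]) q.1) (y' - (c : Ω → ℚ_[p]) q.2) := by
  filter_upwards [(Filter.eventually_all_finite hS).2 fun c _ =>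
    (Filter.eventually_all_finite hS).2 fun c' _ => isFine_of_mem (c - c').2 δ h0] with ⟨x, x'⟩ hq y
  rcases S.eq_empty_or_nonempty with rfl | hne
  · exact ⟨0, by simp⟩
  obtain ⟨c₀, hc₀, hmin⟩ := hS.exists_minimalFor (fun c : B => ‖y - (c : Ω → ℚ_[p]) x‖) S hne
  refine ⟨(c₀ : Ω → ℚ_[p]) x' + (y - (c₀ : Ω → ℚ_[p]) x), fun c hc => RvRel.symm ?_ h1⟩
  have hrel := hq c₀ hc₀ c hc
  change RvRel δ ((c₀ : Ω → ℚ_[p]) x - (c : Ω → ℚ_[p]) x)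
    ((c₀ : Ω → ℚ_[p]) x' - (c : Ω → ℚ_[p]) x') at hrel
  have hle : ‖y - (c₀ : Ω → ℚ_[p]) x‖ ≤ ‖y - (c : Ω → ℚ_[p]) x‖ :=
    (le_total _ _).elim id fun h => hmin hc h
  unfold RvRel
  rw [show (c₀ : Ω → ℚ_[p]) x' + (y - (c₀ : Ω → ℚ_[p]) x) - (c : Ω → ℚ_[p]) x' -
      (y - (c : Ω → ℚ_[p]) x) = ((c₀ : Ω → ℚ_[p]) x' - (c : Ω → ℚ_[p]) x') -
      ((c₀ : Ω → ℚ_[p]) x - (c : Ω → ℚ_[p]) x) by ring]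
  refine le_trans (hrel.symm h1) (mul_le_mul_of_nonneg_left ?_ h0.le)
  simp only
  rw [show (c₀ : Ω → ℚ_[p]) x - (c : Ω → ℚ_[p]) x =
    (y - (c : Ω → ℚ_[p]) x) - (y - (c₀ : Ω → ℚ_[p]) x) by ring]
  exact (norm_sub_le_max _ _).trans (max_le le_rfl hle)

/-- The polynomial functions in one more variable over a ring of functions. -/
noncomputable def polyEval (A : Subring (Ω → ℚ_[p])) : A[X] →+* (Ω × ℚ_[p] → ℚ_[p]) :=
  RingHom.pi fun w => (evalRingHom w.2).comp
    (mapRingHom ((Pi.evalRingHom (fun _ : Ω => ℚ_[p]) w.1).comp A.subtype))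

lemma polyEval_apply (P : A[X]) (w : Ω × ℚ_[p]) : polyEval A P w = (spec w.1 P).eval w.2 := rfl

lemma eventually_exists_iff {T : Ω × ℚ_[p] → Prop}
    (h : ∀ᶠ q in rvFilter (polyEval A).range, T q.1 ↔ T q.2) :
    ∀ᶠ q in rvFilter A, (∃ y, T (q.1, y)) ↔ ∃ y, T (q.2, y) := by
  obtain ⟨s, hsA, hs, δ, h0, h1, h⟩ := eventually_rvFilter.1 h
  obtain ⟨B, hAB, hle, hB⟩ := exists_isRvClosed A
  choose! P hP using fun a (ha : a ∈ s) => RingHom.mem_range.1 (hsA ha)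
  let ι := Subring.inclusion hAB
  have hι : ∀ (P : A[X]) x, spec x (P.map ι) = spec x P := fun P x => by
    rw [spec, spec, Polynomial.map_map]; rfl
  obtain ⟨S, hS, δ', h0', h1', hev⟩ :=
    exists_finite_centers hB (hs.image fun a => (P a).map ι) h0
  have key : ∀ᶠ q in rvFilter B, (∃ y, T (q.1, y)) → ∃ y, T (q.2, y) := by
    filter_upwards [hev, eventually_exists_point hS h0' h1'] with q hq hq' ⟨y, hy⟩
    obtain ⟨y', hy'⟩ := hq' y
    refine ⟨y', (h (q.1, y) (q.2, y') fun a ha => ?_).1 hy⟩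
    rw [← hP a ha, polyEval_apply, polyEval_apply, ← hι, ← hι]
    exact hq y y' hy' _ ⟨a, ha, rfl⟩
  filter_upwards [hle key, hle (eventually_swap key)] with q h1 h2 using ⟨h1, h2⟩

lemma realize_term_mem (hA : ∀ k : ℚ_[p], (fun _ => k) ∈ A) {β : Type}
    (t : (Language.ring[[(Set.univ : Set ℚ_[p])]]).Term β) (v : Ω → β → ℚ_[p])
    (hv : ∀ i, (fun x => v x i) ∈ A) : (fun x => t.realize (v x)) ∈ A := by
  induction t with
  | var i => exact hv i
  | @func l f ts ih =>
    rcases f with f | f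
    · cases f with
      | add => exact add_mem (ih 0) (ih 1)
      | mul => exact mul_mem (ih 0) (ih 1)
      | neg => exact neg_mem (ih 0)
      | zero => exact zero_mem A
      | one => exact one_mem A
    · cases l with
      | zero => exact hA (f : (Set.univ : Set ℚ_[p]))
      | succ l => exact isEmptyElim f

/-- Every formula is invariant along the filter of the ring of polynomial functions. -/
lemma eventually_realize_iff {α : Type} {n : ℕ}
    (φ : (Language.ring[[(Set.univ : Set ℚ_[p])]]).BoundedFormula α n) :
    ∀ {Ω : Type} (A : Subring (Ω → ℚ_[p])) (_ : ∀ k : ℚ_[p], (fun _ => k) ∈ A)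
      (g : Ω → α → ℚ_[p]) (g' : Ω → Fin n → ℚ_[p]) (_ : ∀ i, (fun x => g x i) ∈ A)
      (_ : ∀ i, (fun x => g' x i) ∈ A),
      ∀ᶠ q in rvFilter A, φ.Realize (g q.1) (g' q.1) ↔ φ.Realize (g q.2) (g' q.2) := by
  induction φ with
  | falsum => intros; simp [BoundedFormula.Realize]
  | @equal n t₁ t₂ =>
    intro Ω A hA g g' hg hg'
    have hv : ∀ i, (fun x => Sum.elim (g x) (g' x) i) ∈ A := Sum.forall.2 ⟨hg, hg'⟩
    filter_upwards [isFine_of_mem (sub_mem (realize_term_mem hA t₁ _ hv)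
      (realize_term_mem hA t₂ _ hv)) (1 / 2) (by norm_num)] with q hq
    have := hq.eq_zero_iff (by norm_num)
    simp only [Pi.sub_apply, sub_eq_zero] at this
    exact this
  | rel R _ => rcases R with R | R <;> exact Empty.elim R
  | imp _ _ ih₁ ih₂ =>
    intro Ω A hA g g' hg hg'
    filter_upwards [ih₁ A hA g g' hg hg', ih₂ A hA g g' hg hg'] with q h₁ h₂
    simp only [BoundedFormula.realize_imp, h₁, h₂]
  | @all n φ ih =>
    intro Ω A hA g g' hg hg'
    have hlift : ∀ a ∈ A, (fun w : Ω × ℚ_[p] => a w.1) ∈ (polyEval A).range := fun a ha =>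
      ⟨C ⟨a, ha⟩, by ext w; simp [polyEval_apply, spec]⟩
    have := ih (polyEval A).range (fun k => hlift _ (hA k)) (fun w => g w.1)
      (fun w => Fin.snoc (α := fun _ => ℚ_[p]) (g' w.1) w.2) (fun i => hlift _ (hg i)) (fun i => ?_)
    · have h2 := eventually_exists_iff (T := fun w => ¬ φ.Realize (g w.1)
        (Fin.snoc (α := fun _ => ℚ_[p]) (g' w.1) w.2)) (this.mono fun q hq => not_congr hq)
      filter_upwards [h2] with q hq
      simp only [BoundedFormula.realize_all]
      simpa only [not_exists, not_not] using not_congr hq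
    · refine Fin.lastCases ?_ (fun i => ?_) i
      · simp only [Fin.snoc_last]
        exact ⟨X, by ext w; simp [polyEval_apply, spec]⟩
      · simp only [Fin.snoc_castSucc]
        exact hlift _ (hg' i)

end Elimination

/-! ### Algebraic functions -/

section Algebraic

open Polynomial.Bivariate

lemma exists_mul_add_mul_eq_C {k : Type*} [Field k] {P Q : k[X][Y]} (hP : Irreducible P)
    (hdeg : P.natDegree ≠ 0) (hPQ : ¬ P ∣ Q) :
    ∃ r : k[X], r ≠ 0 ∧ ∃ u v : k[X][Y], u * P + v * Q = C r := by
  set ι := algebraMap k[X] (FractionRing k[X])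
  have hι : Function.Injective ι := IsFractionRing.injective _ _
  have hprim := hP.isPrimitive hdeg
  have hirr := hprim.irreducible_iff_irreducible_map_fraction_map (K := FractionRing k[X]) |>.1 hP
  have hndvd : ¬ P.map ι ∣ Q.map ι := by
    rintro ⟨g, hg⟩
    obtain ⟨g', hg'⟩ := (mem_lifts _).1 (hprim.map_mul_mem_lifts_iff.1
      ((mem_lifts (f := ι) (P.map ι * g)).2 ⟨Q, hg⟩))
    refine hPQ ⟨g', map_injective _ hι ?_⟩
    rw [Polynomial.map_mul, hg, hg']
  obtain ⟨u, v, huv⟩ := hirr.coprime_iff_not_dvd.2 hndvd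
  obtain ⟨a, ha, ha'⟩ := IsLocalization.integerNormalization_spec (nonZeroDivisors k[X]) u
  obtain ⟨b, hb, hb'⟩ := IsLocalization.integerNormalization_spec (nonZeroDivisors k[X]) v
  refine ⟨a * b, mul_ne_zero (nonZeroDivisors.ne_zero ha) (nonZeroDivisors.ne_zero hb),
    C b * IsLocalization.integerNormalization (nonZeroDivisors k[X]) u,
    C a * IsLocalization.integerNormalization (nonZeroDivisors k[X]) v, map_injective _ hι ?_⟩
  have hu : (IsLocalization.integerNormalization (nonZeroDivisors k[X]) u).map ι = C (ι a) * u := by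
    rw [ha', algebra_compatible_smul (FractionRing k[X]), smul_eq_C_mul]
  have hv : (IsLocalization.integerNormalization (nonZeroDivisors k[X]) v).map ι = C (ι b) * v := by
    rw [hb', algebra_compatible_smul (FractionRing k[X]), smul_eq_C_mul]
  simp only [Polynomial.map_add, Polynomial.map_mul, map_C, hu, hv, map_mul]
  linear_combination C (ι a) * C (ι b) * huv

/-- Away from finitely many abscissas, an irreducible curve only meets the curves containing it. -/
lemma eventually_evalEval_ne_zero {k : Type*} [Field k] {P Q : k[X][Y]} (hP : Irreducible P)
    (hdeg : P.natDegree ≠ 0) (hPQ : ¬ P ∣ Q) :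
    ∀ᶠ x in cofinite, ∀ y, P.evalEval x y = 0 → Q.evalEval x y ≠ 0 := by
  obtain ⟨r, hr, u, v, huv⟩ := exists_mul_add_mul_eq_C hP hdeg hPQ
  refine (finite_setOfPred_isRoot hr).subset fun x hx => ?_
  simp only [Set.mem_compl_iff, Set.mem_ofPred_eq, not_forall, not_not] at hx
  obtain ⟨y, hPy, hQy⟩ := hx
  have := congrArg (evalEval x y) huv
  rw [evalEval_add, evalEval_mul, evalEval_mul, hPy, hQy, mul_zero, mul_zero, add_zero,
    evalEval_C] at this
  exact this.symm

lemma exists_irreducible_factor {k : Type*} [Field k] {P : k[X][Y]} {x y : k}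
    (hx : P.map (evalRingHom x) ≠ 0) (h : P.evalEval x y = 0) :
    ∃ R ∈ UniqueFactorizationMonoid.factors P,
      Irreducible R ∧ R.natDegree ≠ 0 ∧ R.evalEval x y = 0 := by
  have hP : P ≠ 0 := by rintro rfl; simp at hx
  have hdvd := (UniqueFactorizationMonoid.factors_prod hP).symm.dvd
  have h0 : ((UniqueFactorizationMonoid.factors P).map (evalEval x y)).prod = 0 := by
    have := evalEval_dvd x y hdvd
    rw [h, zero_dvd_iff, ← coe_evalEvalRingHom, map_multiset_prod] at this
    exact this
  obtain ⟨R, hR, hR0⟩ := Multiset.mem_map.1 (Multiset.prod_eq_zero_iff.1 h0)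
  refine ⟨R, hR, UniqueFactorizationMonoid.irreducible_of_factor R hR, fun hdeg => hx ?_, hR0⟩
  rw [eq_C_of_natDegree_eq_zero hdeg, evalEval_C] at hR0
  obtain ⟨S, rfl⟩ := UniqueFactorizationMonoid.dvd_of_mem_factors hR
  rw [Polynomial.map_mul, eq_C_of_natDegree_eq_zero hdeg, map_C, coe_evalRingHom, hR0, C_0,
    zero_mul]

lemma hasStrictFDerivAt_evalEval (P : ℚ_[p][X][Y]) (w : ℚ_[p] × ℚ_[p]) :
    ∃ D : ℚ_[p] × ℚ_[p] →L[ℚ_[p] ] ℚ_[p],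
      HasStrictFDerivAt (fun w : ℚ_[p] × ℚ_[p] => P.evalEval w.1 w.2) D w ∧
        D (0, 1) = (derivative P).evalEval w.1 w.2 := by
  have han : AnalyticAt ℚ_[p] (fun w : ℚ_[p] × ℚ_[p] => P.evalEval w.1 w.2) w := by
    simp only [evalEval, eval_eq_sum_range (p := P), eval_finsetSum, eval_mul, eval_pow, eval_C,
      ← coe_aeval_eq_eval]
    exact Finset.analyticAt_fun_sum _ fun i _ =>
      (analyticAt_fst.aeval_polynomial _).mul (analyticAt_snd.pow i)
  refine ⟨_, han.hasStrictFDerivAt, ?_⟩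
  have h1 : HasDerivAt (fun t : ℚ_[p] => (w.1, t)) (0, 1) w.2 :=
    (hasDerivAt_const _ _).prodMk (hasDerivAt_id _)
  have h2 := HasFDerivAt.comp_hasDerivAt
    (l := fun w : ℚ_[p] × ℚ_[p] => P.evalEval w.1 w.2) w.2 han.hasStrictFDerivAt.hasFDerivAt h1
  have h3 := (P.map (evalRingHom w.1)).hasDerivAt w.2
  simp only [derivative_map, map_evalRingHom_eval] at h3
  exact h2.unique h3

/-- The implicit function theorem for a polynomial equation in two variables. -/
lemma exists_implicit_function {P : ℚ_[p][X][Y]} {a b : ℚ_[p]} (h0 : P.evalEval a b = 0)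
    (h1 : (derivative P).evalEval a b ≠ 0) :
    ∃ (g : ℚ_[p] → ℚ_[p]) (L : ℚ_[p]), g a = b ∧ HasStrictDerivAt g L a ∧
      ∀ᶠ x in 𝓝 a, P.evalEval x (g x) = 0 := by
  obtain ⟨D, hD, hD'⟩ := hasStrictFDerivAt_evalEval P (a, b)
  have hinv : (D ∘L .inr ℚ_[p] ℚ_[p] ℚ_[p]).IsInvertible :=
    ⟨ContinuousLinearEquiv.unitsEquivAut ℚ_[p] (Units.mk0 _ h1), by ext; simp [hD']⟩
  refine ⟨hD.implicitFunctionOfProdDomain hinv, _, ?_,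
    (hD.hasStrictFDerivAt_implicitFunctionOfProdDomain hinv).hasStrictDerivAt, ?_⟩
  · exact (hD.eventually_apply_eq_iff_implicitFunctionOfProdDomain hinv).self_of_nhds.1 rfl
  · exact (hD.eventually_apply_implicitFunctionOfProdDomain hinv).mono fun x hx => hx.trans h0

lemma eventually_rvRel {Z : Type*} [TopologicalSpace Z] {h : Z → ℚ_[p]} {t : Z}
    (hc : ContinuousAt h t) (h0 : h t ≠ 0) (hδ : 0 < δ) : ∀ᶠ s in 𝓝 t, RvRel δ (h s) (h t) := by
  have : 0 < δ * ‖h t‖ := mul_pos hδ (norm_pos_iff.2 h0)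
  filter_upwards [hc.eventually (Metric.closedBall_mem_nhds _ this)] with s hs
  exact mem_closedBall_iff_norm.1 hs

lemma continuous_evalEval (P : ℚ_[p][X][Y]) :
    Continuous fun w : ℚ_[p] × ℚ_[p] => P.evalEval w.1 w.2 :=
  continuous_iff_continuousAt.2 fun w => by
    obtain ⟨D, hD, -⟩ := hasStrictFDerivAt_evalEval P w
    exact hD.continuousAt

lemma tendsto_slope_of_hasStrictDerivAt {g : ℚ_[p] → ℚ_[p]} {L a : ℚ_[p]}
    (hg : HasStrictDerivAt g L a) :
    Tendsto (fun q : ℚ_[p] × ℚ_[p] => (g q.2 - g q.1) / (q.2 - q.1))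
      (𝓝[{q | q.1 ≠ q.2}] (a, a)) (𝓝 L) := by
  have h := (hg.isLittleO.tendsto_div_nhds_zero.add_const L).mono_left
    (nhdsWithin_le_nhds (s := {q : ℚ_[p] × ℚ_[p] | q.1 ≠ q.2}))
  rw [zero_add] at h
  refine h.congr' ?_
  filter_upwards [self_mem_nhdsWithin] with q (hq : q.1 ≠ q.2)
  have h1 : q.1 - q.2 ≠ 0 := sub_ne_zero.2 hq
  have h2 : q.2 - q.1 ≠ 0 := sub_ne_zero.2 hq.symm
  simp only [ContinuousLinearMap.toSpanSingleton_apply, smul_eq_mul]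
  field_simp
  ring

/-- A set defined by conditions on the leading terms of finitely many polynomials which is a graph
over an open set is locally the graph of an algebraic function, away from finitely many points. -/
lemma eventually_exists_implicit_function {U : Set ℚ_[p]} {f : ℚ_[p] → ℚ_[p]}
    {s : Set ℚ_[p][X][Y]} (hs : s.Finite) (h0 : 0 < δ)
    (h : ∀ x y x' y' : ℚ_[p],
      (∀ P ∈ s, RvRel δ (P.evalEval x y) (P.evalEval x' y')) →
        ((x ∈ U ∧ f x = y) ↔ (x' ∈ U ∧ f x' = y'))) :
    ∀ᶠ a in cofinite, a ∈ U → ∃ g L, HasStrictDerivAt g L a ∧ f =ᶠ[𝓝 a] g := by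
  have hfac : ((⋃ P ∈ s, {R | R ∈ UniqueFactorizationMonoid.factors P}) :
      Set ℚ_[p][X][Y]).Finite :=
    hs.biUnion fun P _ => Multiset.finite_toSet _
  have hder : ∀ R : ℚ_[p][X][Y], R.natDegree ≠ 0 → ¬ R ∣ derivative R := fun R hR hdvd =>
    (natDegree_derivative_lt hR).not_ge
      (natDegree_le_of_dvd hdvd fun h => hR (derivative_eq_zero.1 h))
  have hgen : ∀ᶠ x in cofinite, ∀ R ∈ ⋃ P ∈ s, {R | R ∈ UniqueFactorizationMonoid.factors P},
      ∀ Q ∈ insert (derivative R) s, Irreducible R → R.natDegree ≠ 0 → ¬ R ∣ Q →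
        ∀ y, R.evalEval x y = 0 → Q.evalEval x y ≠ 0 :=
    (Filter.eventually_all_finite hfac).2 fun R _ =>
      (Filter.eventually_all_finite (hs.insert _)).2 fun Q _ => by
        by_cases hR : Irreducible R ∧ R.natDegree ≠ 0 ∧ ¬ R ∣ Q
        · exact (eventually_evalEval_ne_zero hR.1 hR.2.1 hR.2.2).mono fun x hx _ _ _ => hx
        · exact .of_forall fun x h1 h2 h3 => absurd ⟨h1, h2, h3⟩ hR
  filter_upwards [hgen] with a ha haU
  obtain ⟨P, hPs, hPa, hPf⟩ : ∃ P ∈ s, P.map (evalRingHom a) ≠ 0 ∧ P.evalEval a (f a) = 0 := by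
    by_contra! hcon
    have hev : ∀ᶠ y in 𝓝 (f a), ∀ P ∈ s, RvRel δ (P.evalEval a y) (P.evalEval a (f a)) := by
      refine (Filter.eventually_all_finite hs).2 fun P hP => ?_
      by_cases hPa : P.map (evalRingHom a) = 0
      · refine .of_forall fun y => ?_
        rw [← map_evalRingHom_eval, ← map_evalRingHom_eval, hPa, eval_zero, eval_zero]
        exact .refl h0.le _
      · exact eventually_rvRel (h := fun y => P.evalEval a y) (((continuous_evalEval P).comp
          (Continuous.prodMk_right a)).continuousAt) (hcon P hP hPa) h0
    obtain ⟨y, hy, hne⟩ := ((hev.filter_mono nhdsWithin_le_nhds).and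
      (self_mem_nhdsWithin (s := {f a}ᶜ))).exists
    exact hne ((h a y a (f a) hy).2 ⟨haU, rfl⟩).2.symm
  obtain ⟨R, hRP, hR, hRdeg, hR0⟩ := exists_irreducible_factor hPa hPf
  have hRa := fun Q hQ h => ha R (Set.mem_biUnion hPs hRP) Q hQ hR hRdeg h (f a) hR0
  obtain ⟨g, L, hga, hg, hRg⟩ := exists_implicit_function hR0
    (hRa _ (Set.mem_insert _ _) (hder R hRdeg))
  refine ⟨g, L, hg, ?_⟩
  have hev : ∀ᶠ x in 𝓝 a, ∀ Q ∈ s, RvRel δ (Q.evalEval x (g x)) (Q.evalEval a (f a)) := by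
    refine (Filter.eventually_all_finite hs).2 fun Q hQ => ?_
    by_cases hdvd : R ∣ Q
    · filter_upwards [hRg] with x hx
      have h1 := evalEval_dvd x (g x) hdvd
      have h2 := evalEval_dvd a (f a) hdvd
      rw [hx, zero_dvd_iff] at h1
      rw [hR0, zero_dvd_iff] at h2
      rw [h1, h2]
      exact .refl h0.le _
    · have hc : ContinuousAt (fun x => Q.evalEval x (g x)) a :=
        (continuous_evalEval Q).continuousAt.comp (f := fun x => (x, g x))
          (continuousAt_id.prodMk hg.hasDerivAt.continuousAt)
      have := eventually_rvRel hc (by rw [hga]; exact hRa Q (.inr hQ) hdvd) h0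
      simpa only [hga] using this
  filter_upwards [hev] with x hx
  exact ((h x (g x) a (f a) hx).2 ⟨haU, rfl⟩).2

/-- A definable set in the plane is defined by conditions on the leading terms of finitely many
polynomials. -/
lemma exists_finite_polynomials {T : Set (Fin 2 → ℚ_[p])}
    (hT : Set.Definable (Set.univ : Set ℚ_[p]) FirstOrder.Language.ring T) :
    ∃ s : Set ℚ_[p][X][Y], s.Finite ∧ ∃ δ : ℝ, 0 < δ ∧ ∀ x y x' y' : ℚ_[p],
      (∀ P ∈ s, RvRel δ (P.evalEval x y) (P.evalEval x' y')) → (![x, y] ∈ T ↔ ![x', y'] ∈ T) := by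
  obtain ⟨φ, rfl⟩ := hT
  let Φ : ℚ_[p][X][Y] →+* (ℚ_[p] × ℚ_[p] → ℚ_[p]) := RingHom.pi fun w => evalEvalRingHom w.1 w.2
  have hΦ : ∀ P w, Φ P w = P.evalEval w.1 w.2 := fun _ _ => rfl
  obtain ⟨s, hsA, hs, δ, h0, -, h⟩ := eventually_rvFilter.1 (eventually_realize_iff φ Φ.range
    (fun k => ⟨CC k, by ext w; simp [hΦ]⟩) (fun w => ![w.1, w.2])
    (fun _ => @default (Fin 0 → ℚ_[p]) Unique.instInhabited)
    (Fin.forall_fin_two.2 ⟨⟨C X, by ext w; simp [hΦ, evalEval_C]⟩, ⟨X, by ext w; simp [hΦ]⟩⟩)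
    (fun i => i.elim0))
  choose! P hP using fun a (ha : a ∈ s) => RingHom.mem_range.1 (hsA ha)
  refine ⟨P '' s, hs.image P, δ, h0, fun x y x' y' hxy => ?_⟩
  simp only [Set.mem_ofPred_eq, Language.Formula.Realize]
  refine h (x, y) (x', y') fun a ha => ?_
  rw [← hP a ha]
  exact hxy _ ⟨a, ha, rfl⟩

end Algebraic

end PadicDefinable

/-- **Generic strict differentiability in one variable over `ℚ_p`.**
If `U ⊆ ℚ_p` is open and `f : ℚ_p → ℚ_p` has a graph over `U` that is definable (with
parameters) in the language of rings, then there is a finite set `F ⊆ U` such that at every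
point `a ∈ U \ F`, `f` is strictly differentiable within `U`. -/
theorem stmt0 (p : ℕ) [Fact p.Prime] (U : Set ℚ_[p]) (hUopen : IsOpen U)
    (f : ℚ_[p] → ℚ_[p])
    (hfdef : Set.Definable (Set.univ : Set ℚ_[p]) FirstOrder.Language.ring
      {v : Fin 2 → ℚ_[p] | v 0 ∈ U ∧ f (v 0) = v 1}) :
    ∃ F : Set ℚ_[p], F.Finite ∧ F ⊆ U ∧
      ∀ a ∈ U \ F, ∃ L : ℚ_[p],
        Filter.Tendsto (fun q : ℚ_[p] × ℚ_[p] => (f q.2 - f q.1) / (q.2 - q.1))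
          (𝓝[{q : ℚ_[p] × ℚ_[p] | q.1 ∈ U ∧ q.2 ∈ U ∧ q.1 ≠ q.2}] (a, a)) (𝓝 L) := by
  obtain ⟨s, hs, δ, h0, h⟩ := PadicDefinable.exists_finite_polynomials hfdef
  have hfin := PadicDefinable.eventually_exists_implicit_function hs h0 h
  refine ⟨{a | ¬ (a ∈ U → ∃ g L, HasStrictDerivAt g L a ∧ f =ᶠ[𝓝 a] g)}, hfin,
    fun a ha => (Classical.not_imp.1 ha).1, fun a ha => ?_⟩
  obtain ⟨g, L, hg, hfg⟩ := not_not.1 ha.2 ha.1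
  refine ⟨L, ((PadicDefinable.tendsto_slope_of_hasStrictDerivAt hg).mono_left
    (nhdsWithin_mono _ fun q hq => hq.2.2)).congr' ?_⟩
  filter_upwards [nhdsWithin_le_nhds (hfg.prodMk_nhds hfg)] with q hq
  rw [hq.1, hq.2]
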